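/- arXiv:1903.08332 — 2 statements merged into one kernel-verified Lean document; each statement's English description precedes it below -/
import Mathlib

section
/- Let G be a bi-regular bipartite graph with degrees q_1+1 on side U (|U| = n) and q_2+1 on side W (|W| = m), adjacency matrix A with biadjacency block D, and directed edge matrix A_e. If the kernel of D is nonzero (equivalently m > Rank(A)/2), then −q_2 is an eigenvalue of A_e² with multiplicity at least 2m − Rank(A); symmetrically, if Ker(D^t) ≠ 0 then −q_1 is an eigenvalue of A_e² with multiplicity at least 2n − Rank(A). -/
open SimpleGraph Matrix Polynomial

/-- The directed edge matrix of a graph. -/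
def edgeMatrix {V : Type*} [DecidableEq V] (G : SimpleGraph V) [DecidableRel G.Adj]
    (R : Type*) [Zero R] [One R] : Matrix G.Dart G.Dart R :=
  fun e f => if e.snd = f.fst ∧ f ≠ e.symm then 1 else 0


theorem edge_mulVec_aux {V : Type*} [Fintype V] [DecidableEq V] (G : SimpleGraph V)
    [DecidableRel G.Adj] (h : V → V → ℝ) (e : G.Dart) :
    (edgeMatrix G ℝ *ᵥ fun f : G.Dart => h f.fst f.snd) e
      = ∑ v ∈ G.neighborFinset e.snd, h e.snd v - h e.snd e.fst := by
  have h1 : ∑ v ∈ G.neighborFinset e.snd, h e.snd v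
      = ∑ f : G.Dart, if f.fst = e.snd then h f.fst f.snd else 0 := by
    rw [← Finset.sum_filter]
    refine Finset.sum_bij' (fun v hv => (⟨(e.snd, v), by simpa using hv⟩ : G.Dart))
      (fun f _ => f.snd) ?_ ?_ ?_ ?_ ?_
    · intro v hv; simp
    · intro f hf
      have hf' : f.fst = e.snd := by simpa using hf
      have := f.adj
      rw [hf'] at this
      simpa using this
    · intro v hv; rfl
    · intro f hf
      have hf' : f.fst = e.snd := by simpa using hf
      apply Dart.ext
      exact Prod.ext hf'.symm rfl
    · intro v hv; rfl
  have h2 : h e.snd e.fst = ∑ f : G.Dart, if f = e.symm then h f.fst f.snd else 0 := by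
    rw [Finset.sum_ite_eq' Finset.univ e.symm, if_pos (Finset.mem_univ _)]
    rfl
  rw [h1, h2, ← Finset.sum_sub_distrib]
  simp only [mulVec, dotProduct, edgeMatrix]
  refine Finset.sum_congr rfl fun f _ => ?_
  by_cases hf : f = e.symm
  · subst hf; simp [Dart.symm]
  · simp [hf, eq_comm]

theorem mult_aux {V : Type*} [Fintype V] [DecidableEq V] (G : SimpleGraph V)
    [DecidableRel G.Adj] (S : V → Prop) (q : ℕ)
    (hbip : ∀ a b, G.Adj a b → S a → ¬ S b)
    (hdeg : ∀ v, S v → G.degree v = q + 1)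
    (K : Submodule ℝ (V → ℝ))
    (hS : ∀ x ∈ K, ∀ v, ¬ S v → x v = 0)
    (hK : ∀ x ∈ K, ∀ v, ∑ u ∈ G.neighborFinset v, x u = 0) :
    2 * Module.finrank ℝ K ≤
      (((edgeMatrix G ℂ) ^ 2).charpoly).rootMultiplicity (-(q : ℂ)) := by
  have hmap : (edgeMatrix G ℂ) ^ 2 = ((edgeMatrix G ℝ) ^ 2).map Complex.ofRealHom := by
    rw [Matrix.map_pow]
    congr 1
    ext e f
    simp only [edgeMatrix, Matrix.map_apply]
    split_ifs <;> simp
  have hq : (-(q : ℂ)) = Complex.ofRealHom (-(q : ℝ)) := by simp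
  rw [hmap, Matrix.charpoly_map, hq,
    ← Polynomial.eq_rootMultiplicity_map Complex.ofRealHom.injective,
    ← Matrix.charpoly_mulVecLin]
  refine le_trans ?_ (LinearMap.finrank_eigenspace_le _ _)
  let Φ : (K × K) →ₗ[ℝ] (G.Dart → ℝ) :=
    { toFun := fun p e => p.1.1 e.snd + p.2.1 e.fst
      map_add' := by intro p p'; ext e; simp; ring
      map_smul' := by intro c p; ext e; simp; ring }
  have hT : ∀ p : K × K, edgeMatrix G ℝ *ᵥ (Φ p)
      = fun e => -p.1.1 e.fst + q * p.2.1 e.snd := by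
    intro p
    ext e
    have := edge_mulVec_aux G (fun a b => p.1.1 b + p.2.1 a) e
    refine this.trans ?_
    rw [Finset.sum_add_distrib, hK _ p.1.2]
    by_cases hs : S e.snd
    · simp [hdeg _ hs]; ring
    · simp [hS _ p.2.2 _ hs]
  have hT' : ∀ p : K × K, edgeMatrix G ℝ *ᵥ (Φ p) = Φ ((q : ℝ) • p.2, -p.1) := by
    intro p
    rw [hT]; ext e; simp [Φ]; ring
  have hmem : ∀ p, Φ p ∈ Module.End.eigenspace (((edgeMatrix G ℝ) ^ 2).mulVecLin) (-(q : ℝ)) := by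
    intro p
    rw [Module.End.mem_eigenspace_iff, Matrix.mulVecLin_apply, pow_two, ← Matrix.mulVec_mulVec,
      hT', hT', ← map_smul]
    congr 1
    ext <;> simp
  have hinj : Function.Injective Φ := by
    rw [injective_iff_map_eq_zero]
    intro p hp
    have key : ∀ v, p.1.1 v = 0 ∧ p.2.1 v = 0 := by
      intro v
      by_cases hs : S v
      · have hpos : 0 < G.degree v := by rw [hdeg v hs]; omega
        obtain ⟨u, hu⟩ := (G.degree_pos_iff_exists_adj v).1 hpos
        have hnu := hbip _ _ hu hs
        have e1 := congrFun hp ⟨(u, v), hu.symm⟩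
        have e2 := congrFun hp ⟨(v, u), hu⟩
        simp only [Φ, LinearMap.coe_mk, AddHom.coe_mk, Pi.zero_apply] at e1 e2
        rw [hS _ p.2.2 u hnu, add_zero] at e1
        rw [hS _ p.1.2 u hnu, zero_add] at e2
        exact ⟨e1, e2⟩
      · exact ⟨hS _ p.1.2 v hs, hS _ p.2.2 v hs⟩
    refine Prod.ext (Subtype.ext (funext fun v => (key v).1)) (Subtype.ext (funext fun v => (key v).2))
  have := LinearMap.finrank_le_finrank_of_injective
    (f := Φ.codRestrict _ hmem) (by
      intro a b hab; exact hinj (congrArg Subtype.val hab))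
  rw [Module.finrank_prod] at this
  omega

theorem rank_aux {U W : Type*} [Fintype U] [Fintype W] (D : Matrix U W ℝ) :
    2 * D.rank ≤ (Matrix.fromBlocks 0 D Dᵀ 0).rank := by
  have h2 : 2 * D.rank = D.rank + Dᵀ.rank := by rw [Matrix.rank_transpose]; omega
  rw [h2]
  unfold Matrix.rank
  rw [← Module.finrank_prod]
  let Ψ : (LinearMap.range D.mulVecLin × LinearMap.range Dᵀ.mulVecLin) →ₗ[ℝ] (U ⊕ W → ℝ) :=
    { toFun := fun p => Sum.elim p.1.1 p.2.1
      map_add' := by intro p p'; ext (e | e) <;> simp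
      map_smul' := by intro c p; ext (e | e) <;> simp }
  have hmem : ∀ p, Ψ p ∈ LinearMap.range (Matrix.fromBlocks 0 D Dᵀ 0).mulVecLin := by
    rintro ⟨⟨_, x, rfl⟩, ⟨_, y, rfl⟩⟩
    refine ⟨Sum.elim y x, ?_⟩
    rw [Matrix.mulVecLin_apply, Matrix.fromBlocks_mulVec]
    ext (e | e) <;> simp [Ψ, Matrix.mulVec_transpose, Function.comp_def]
  refine LinearMap.finrank_le_finrank_of_injective (f := Ψ.codRestrict _ hmem) ?_
  intro a b hab
  have h := congrArg Subtype.val hab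
  refine Prod.ext (Subtype.ext (funext fun v => ?_)) (Subtype.ext (funext fun v => ?_))
  · exact congrFun h (Sum.inl v)
  · exact congrFun h (Sum.inr v)

theorem nullity_aux {U W : Type*} [Fintype U] [Fintype W] (D : Matrix U W ℝ) :
    D.rank + Module.finrank ℝ (LinearMap.ker D.mulVecLin) = Fintype.card W := by
  have := LinearMap.finrank_range_add_finrank_ker D.mulVecLin
  simpa [Matrix.rank] using this

/-- For a bi-regular bipartite graph with degrees `q₁+1` on `U` (`|U| = n`) and `q₂+1`
on `W` (`|W| = m`), biadjacency block `D` and directed edge matrix `A_e`: if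
`Ker D ≠ 0` then `-q₂` is an eigenvalue of `A_e²` with algebraic multiplicity at least
`2m - Rank A`; symmetrically, if `Ker Dᵀ ≠ 0` then `-q₁` is an eigenvalue of `A_e²`
with algebraic multiplicity at least `2n - Rank A`. -/
theorem eigenvalue_multiplicity_from_kernel {U W : Type*}
    [Fintype U] [Fintype W] [DecidableEq U] [DecidableEq W]
    (G : SimpleGraph (U ⊕ W)) [DecidableRel G.Adj]
    (hbipL : ∀ u u' : U, ¬ G.Adj (Sum.inl u) (Sum.inl u'))
    (hbipR : ∀ w w' : W, ¬ G.Adj (Sum.inr w) (Sum.inr w'))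
    (q₁ q₂ : ℕ)
    (hdegU : ∀ u : U, G.degree (Sum.inl u) = q₁ + 1)
    (hdegW : ∀ w : W, G.degree (Sum.inr w) = q₂ + 1)
    (D : Matrix U W ℝ)
    (hD : D = fun u w => if G.Adj (Sum.inl u) (Sum.inr w) then 1 else 0) :
    (LinearMap.ker D.mulVecLin ≠ ⊥ →
      2 * Fintype.card W - (G.adjMatrix ℝ).rank ≤
        (((edgeMatrix G ℂ) ^ 2).charpoly).rootMultiplicity (-(q₂ : ℂ))) ∧
    (LinearMap.ker Dᵀ.mulVecLin ≠ ⊥ →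
      2 * Fintype.card U - (G.adjMatrix ℝ).rank ≤
        (((edgeMatrix G ℂ) ^ 2).charpoly).rootMultiplicity (-(q₁ : ℂ))) := by
  have hA : G.adjMatrix ℝ = Matrix.fromBlocks 0 D Dᵀ 0 := by
    subst hD
    ext (a | a) (b | b) <;> simp [SimpleGraph.adjMatrix_apply, hbipL, hbipR, G.adj_comm, Matrix.fromBlocks, Matrix.transpose]
  have hr := rank_aux D
  rw [← hA] at hr
  have hAv : ∀ x : U ⊕ W → ℝ, ∀ v, ∑ u ∈ G.neighborFinset v, x u
      = (Matrix.fromBlocks 0 D Dᵀ 0 *ᵥ x) v := by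
    intro x v
    rw [← hA, SimpleGraph.adjMatrix_mulVec_apply]
  constructor
  · intro _
    let ι : (W → ℝ) →ₗ[ℝ] (U ⊕ W → ℝ) :=
      { toFun := fun x => Sum.elim 0 x
        map_add' := by intro p p'; ext (e | e) <;> simp
        map_smul' := by intro c p; ext (e | e) <;> simp }
    have hι : Function.Injective ι := fun a b h => funext fun w => congrFun h (Sum.inr w)
    have := mult_aux G (fun v => v.isRight) q₂ (by
        rintro (a | a) (b | b) h <;> simp_all) (by
        rintro (a | a) h <;> simp_all) ((LinearMap.ker D.mulVecLin).map ι) (by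
        rintro _ ⟨x, hx, rfl⟩ (v | v) h
        · rfl
        · simp at h) (by
        rintro _ ⟨x, hx, rfl⟩ v
        have hx' : D *ᵥ x = 0 := hx
        rw [hAv]
        rcases v with v | v <;> simp [ι, Matrix.fromBlocks_mulVec, hx'])
    rw [← (Submodule.equivMapOfInjective ι hι _).finrank_eq] at this
    have hn := nullity_aux D
    omega
  · intro _
    let ι : (U → ℝ) →ₗ[ℝ] (U ⊕ W → ℝ) :=
      { toFun := fun x => Sum.elim x 0
        map_add' := by intro p p'; ext (e | e) <;> simp
        map_smul' := by intro c p; ext (e | e) <;> simp }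
    have hι : Function.Injective ι := fun a b h => funext fun w => congrFun h (Sum.inl w)
    have := mult_aux G (fun v => v.isLeft) q₁ (by
        rintro (a | a) (b | b) h <;> simp_all) (by
        rintro (a | a) h <;> simp_all) ((LinearMap.ker Dᵀ.mulVecLin).map ι) (by
        rintro _ ⟨x, hx, rfl⟩ (v | v) h
        · simp at h
        · rfl) (by
        rintro _ ⟨x, hx, rfl⟩ v
        have hx' : Dᵀ *ᵥ x = 0 := hx
        rw [hAv]
        rcases v with v | v <;> simp [ι, Matrix.fromBlocks_mulVec, hx'])
    rw [← (Submodule.equivMapOfInjective ι hι _).finrank_eq] at this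
    have hn := nullity_aux Dᵀ
    rw [Matrix.rank_transpose] at hn
    omega
end

section
/- Let G be a connected bi-regular bipartite graph with degrees q_1+1, q_2+1, adjacency matrix A of size (n+m), and directed edge matrix A_e of size 2|E|. Then the sum over all eigenvalues η of A_e of η^k can be computed as: Σ over negative eigenvalues λ of A (with multiplicity) of (ξ_1(λ)^{k/2} + ξ_2(λ)^{k/2})·2 restricted to roots ξ ≠ 1 of ξ²+(−λ²+q_1+q_2)ξ+q_1q_2=0, plus (2n − Rank(A))·(−q_1)^{k/2} + (2m − Rank(A))·(−q_2)^{k/2} + (2|E| − 2(n+m) + 2)·1, for every even k. -/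
open SimpleGraph Matrix Polynomial

theorem aux_block_det {R U W : Type*} [CommRing R] [Fintype U] [Fintype W] [DecidableEq U]
    [DecidableEq W] (B : Matrix U W R) (a b d : R) :
    (Matrix.fromBlocks (a • (1 : Matrix U U R)) (-(b • B)) (-(b • Bᵀ))
      (d • (1 : Matrix W W R))).det * a ^ Fintype.card W =
    a ^ Fintype.card U * ((a * d) • (1 : Matrix W W R) - (b * b) • (Bᵀ * B)).det := by
  have h : Matrix.fromBlocks (a • (1 : Matrix U U R)) (-(b • B)) (-(b • Bᵀ))
      (d • (1 : Matrix W W R)) * Matrix.fromBlocks 1 (b • B) 0 (a • (1 : Matrix W W R)) =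
      Matrix.fromBlocks (a • (1 : Matrix U U R)) 0 (-(b • Bᵀ))
        ((a * d) • (1 : Matrix W W R) - (b * b) • (Bᵀ * B)) := by
    rw [Matrix.fromBlocks_multiply]
    congr 1
    · simp
    · simp [smul_smul, mul_comm]
    · simp
    · simp [smul_smul]
      abel
  have h2 := congrArg Matrix.det h
  rw [Matrix.det_mul, Matrix.det_fromBlocks_zero₂₁, Matrix.det_fromBlocks_zero₁₂] at h2
  simpa [Matrix.det_smul] using h2

theorem aux_herm_det {R W : Type*} [CommRing R] [Fintype W] [DecidableEq W]
    (N : Matrix W W ℝ) (hN : N.IsHermitian) (φ : ℝ →+* R) (a b : R) :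
    (a • (1 : Matrix W W R) - b • N.map φ).det = ∏ i, (a - b * φ (hN.eigenvalues i)) := by
  obtain ⟨P, Q, hPQ, hN'⟩ : ∃ P Q : Matrix W W ℝ, P * Q = 1 ∧
      N = P * Matrix.diagonal hN.eigenvalues * Q := by
    refine ⟨hN.eigenvectorUnitary, star (hN.eigenvectorUnitary : Matrix W W ℝ), ?_, ?_⟩
    · simp
    · have := hN.spectral_theorem
      rw [Unitary.conjStarAlgAut_apply] at this
      exact this
  have h1 : P.map φ * Q.map φ = 1 := by
    rw [← Matrix.map_mul, hPQ]; simp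
  have h2 : N.map φ = P.map φ * Matrix.diagonal (fun i => φ (hN.eigenvalues i)) * Q.map φ := by
    conv_lhs => rw [hN']
    rw [Matrix.map_mul, Matrix.map_mul]
    congr 2
    simp [Matrix.diagonal_map]
  have h3 : a • (1 : Matrix W W R) - b • N.map φ =
      P.map φ * Matrix.diagonal (fun i => a - b * φ (hN.eigenvalues i)) * Q.map φ := by
    have : Matrix.diagonal (fun i => a - b * φ (hN.eigenvalues i)) =
      a • (1 : Matrix W W R) - b • Matrix.diagonal (fun i => φ (hN.eigenvalues i)) := by
      ext i k
      by_cases h : i = k <;> simp [h]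
    rw [this, h2, ← h1]
    simp [Matrix.mul_sub, Matrix.sub_mul, h1]
  rw [h3, Matrix.det_mul, Matrix.det_mul, Matrix.det_diagonal, mul_right_comm, ← Matrix.det_mul, h1]
  simp

theorem aux_det_comm {R m n : Type*} [CommRing R] [Fintype m] [Fintype n] [DecidableEq m]
    [DecidableEq n] (P : Matrix m n R) (Q : Matrix n m R) (c : R) :
    c ^ Fintype.card n * (c • (1 : Matrix m m R) - P * Q).det =
      c ^ Fintype.card m * (c • (1 : Matrix n n R) - Q * P).det := by
  have := congrArg (Polynomial.eval c) (Matrix.charpoly_mul_comm' P Q)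
  simpa [Matrix.eval_charpoly, Matrix.smul_one_eq_diagonal] using this

/-- dart reversal -/
def auxJ {V : Type*} [DecidableEq V] (G : SimpleGraph V)
    (R : Type*) [Zero R] [One R] : Matrix G.Dart G.Dart R :=
  fun e f => if f = e.symm then 1 else 0

theorem auxJ_sq {V : Type*} [Fintype V] [DecidableEq V] (G : SimpleGraph V) [DecidableRel G.Adj]
    (R : Type*) [CommRing R] : auxJ G R * auxJ G R = 1 := by
  ext e f
  rw [Matrix.mul_apply, Finset.sum_eq_single e.symm]
  · simp [auxJ, Matrix.one_apply, eq_comm]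
  · intro b _ hb
    simp [auxJ, hb]
  · simp

theorem aux_ihara {V : Type*} [Fintype V] [DecidableEq V] (G : SimpleGraph V) [DecidableRel G.Adj]
    {R : Type*} [CommRing R] (x : R) :
    (x • (1 : Matrix G.Dart G.Dart R) - auxJ G R).det *
      (x • (1 : Matrix G.Dart G.Dart R) - edgeMatrix G R).det * (x ^ 2 - 1) ^ Fintype.card V =
    (x ^ 2 - 1) ^ Fintype.card G.Dart *
      ((x ^ 2 - 1) • (1 : Matrix V V R) - x • G.adjMatrix R + G.degMatrix R).det := by
  obtain ⟨S, hS⟩ : ∃ S : Matrix V G.Dart R, ∀ v e, S v e = if e.fst = v then 1 else 0 :=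
    ⟨Matrix.of fun v e => if e.fst = v then 1 else 0, fun _ _ => rfl⟩
  obtain ⟨T, hT⟩ : ∃ T : Matrix V G.Dart R, ∀ v e, T v e = if e.snd = v then 1 else 0 :=
    ⟨Matrix.of fun v e => if e.snd = v then 1 else 0, fun _ _ => rfl⟩
  have hM : edgeMatrix G R = Tᵀ * S - auxJ G R := by
    ext e f
    have : (Tᵀ * S) e f = if e.snd = f.fst then 1 else 0 := by
      simp [Matrix.mul_apply, hS, hT, eq_comm]
    rw [Matrix.sub_apply, this]
    unfold edgeMatrix auxJ
    by_cases h : f = e.symm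
    · subst h; simp
    · simp [h]
  have hJT : auxJ G R * Tᵀ = Sᵀ := by
    ext e v
    rw [Matrix.mul_apply, Finset.sum_eq_single e.symm]
    · simp [hS, hT, auxJ]
    · intro b _ hb
      simp [auxJ, hb]
    · simp
  have hST : S * Tᵀ = G.adjMatrix R := by
    ext u v
    simp only [Matrix.mul_apply, hS, hT, Matrix.transpose_apply, SimpleGraph.adjMatrix_apply]
    by_cases h : G.Adj u v
    · rw [Finset.sum_eq_single (⟨(u, v), h⟩ : G.Dart)]
      · simp [h]
      · intro b _ hb
        by_cases h1 : b.fst = u <;> by_cases h2 : b.snd = v <;> simp [h1, h2]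
        exact absurd (SimpleGraph.Dart.ext _ _ (Prod.ext h1 h2)) hb
      · simp
    · rw [if_neg h]
      apply Finset.sum_eq_zero
      intro b _
      by_cases h1 : b.fst = u <;> by_cases h2 : b.snd = v <;> simp [h1, h2]
      exact absurd (h1 ▸ h2 ▸ b.adj) h
  have hSS : S * Sᵀ = G.degMatrix R := by
    ext u v
    simp only [Matrix.mul_apply, hS, Matrix.transpose_apply, SimpleGraph.degMatrix]
    by_cases h : u = v
    · subst h
      simp only [Matrix.diagonal_apply_eq, ← SimpleGraph.dart_fst_fiber_card_eq_degree, mul_ite, mul_one,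
        mul_zero, ← ite_and, and_self]
      simp
    · rw [Matrix.diagonal_apply_ne _ h]
      apply Finset.sum_eq_zero
      intro b _
      by_cases h1 : b.fst = u
      · simp [h1, h]
      · simp [h1]
  have key : (x • (1 : Matrix G.Dart G.Dart R) - auxJ G R) *
      (x • (1 : Matrix G.Dart G.Dart R) - edgeMatrix G R) =
      (x ^ 2 - 1) • (1 : Matrix G.Dart G.Dart R)
        - ((x • (1 : Matrix G.Dart G.Dart R) - auxJ G R) * Tᵀ) * S := by
    rw [hM, Matrix.mul_assoc _ Tᵀ S]
    have h1 : x • (1 : Matrix G.Dart G.Dart R) - (Tᵀ * S - auxJ G R) =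
      (x • (1 : Matrix G.Dart G.Dart R) + auxJ G R) - Tᵀ * S := by abel
    rw [h1, Matrix.mul_sub]
    congr 1
    rw [Matrix.sub_mul, Matrix.mul_add, Matrix.mul_add, auxJ_sq]
    simp [smul_smul, sub_smul, pow_two]
    abel
  rw [← Matrix.det_mul, key, mul_comm, aux_det_comm]
  congr 2
  rw [← Matrix.mul_assoc] 
  rw [Matrix.mul_sub, Matrix.sub_mul, Matrix.mul_assoc S (auxJ G R), hJT, hSS]
  simp [hST]
  abel

/-- even power sum of the roots -/
noncomputable def auxP (j : ℕ) (p : ℂ[X]) : ℂ := (p.roots.map (fun η => η ^ (2 * j))).sum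

theorem auxP_mul (j : ℕ) {p q : ℂ[X]} (hp : p ≠ 0) (hq : q ≠ 0) :
    auxP j (p * q) = auxP j p + auxP j q := by
  simp [auxP, Polynomial.roots_mul (mul_ne_zero hp hq)]

theorem auxP_pow (j : ℕ) (p : ℂ[X]) (n : ℕ) : auxP j (p ^ n) = n * auxP j p := by
  simp [auxP, Polynomial.roots_pow, Multiset.map_nsmul, Multiset.sum_nsmul]

theorem auxP_prod (j : ℕ) {ι : Type*} (s : Finset ι) (f : ι → ℂ[X]) (hf : ∀ i ∈ s, f i ≠ 0) :
    auxP j (∏ i ∈ s, f i) = ∑ i ∈ s, auxP j (f i) := by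
  classical
  induction s using Finset.induction_on with
  | empty => simp [auxP]
  | insert a s ha ih =>
    rw [Finset.prod_insert ha, Finset.sum_insert ha, auxP_mul j (hf a (by simp)), ih]
    · intro i hi; exact hf i (by simp [hi])
    · exact Finset.prod_ne_zero_iff.mpr fun i hi => hf i (by simp [hi])

theorem aux_sq_ne (a : ℂ) : (X ^ 2 - C a : ℂ[X]) ≠ 0 :=
  Polynomial.X_pow_sub_C_ne_zero (by norm_num) a

theorem auxP_sq (j : ℕ) (a : ℂ) : auxP j (X ^ 2 - C a) = 2 * a ^ j := by
  obtain ⟨s, hs⟩ := IsAlgClosed.exists_pow_nat_eq a (n := 2) (by norm_num)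
  have h : (X ^ 2 - C a : ℂ[X]) = (X - C s) * (X - C (-s)) := by
    rw [← hs]; simp only [map_pow, map_neg]; ring
  rw [h, auxP_mul j (X_sub_C_ne_zero s) (X_sub_C_ne_zero _)]
  simp [auxP, pow_mul, hs]
  ring

theorem aux_quad (b c : ℂ) : ∃ x y : ℂ, (X ^ 2 + C b * X + C c : ℂ[X]) = (X - C x) * (X - C y) := by
  obtain ⟨s, hs⟩ := IsAlgClosed.exists_pow_nat_eq (b ^ 2 - 4 * c) (n := 2) (by norm_num)
  refine ⟨(-b + s) / 2, (-b - s) / 2, ?_⟩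
  have h1 : b = -((-b + s) / 2 + (-b - s) / 2) := by ring
  have h2 : c = ((-b + s) / 2) * ((-b - s) / 2) := by linear_combination (1 / 4) * hs
  conv_lhs => rw [h1, h2]
  simp only [map_neg, map_add, map_mul]
  ring

theorem aux_roots2 (x y : ℂ) : ((X - C x) * (X - C y) : ℂ[X]).roots = {x, y} := by
  rw [Polynomial.roots_mul (mul_ne_zero (X_sub_C_ne_zero _) (X_sub_C_ne_zero _))]
  simp

/-- The quadratic -/
noncomputable def auxQ (q₁ q₂ : ℕ) (m : ℂ) : ℂ[X] :=
  X ^ 2 + C (-m + q₁ + q₂) * X + C ((q₁ : ℂ) * q₂)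

theorem aux_quartic (q₁ q₂ : ℕ) (j : ℕ) (m : ℂ) :
    ((X ^ 2 + C (q₁ : ℂ)) * (X ^ 2 + C (q₂ : ℂ)) - X * X * C m : ℂ[X]) ≠ 0 ∧
    auxP j ((X ^ 2 + C (q₁ : ℂ)) * (X ^ 2 + C (q₂ : ℂ)) - X * X * C m) =
      2 * ((auxQ q₁ q₂ m).roots.map (fun ξ => ξ ^ j)).sum := by
  obtain ⟨x, y, h⟩ := aux_quad (-m + q₁ + q₂) ((q₁ : ℂ) * q₂)
  have h2 : ((X ^ 2 + C (q₁ : ℂ)) * (X ^ 2 + C (q₂ : ℂ)) - X * X * C m : ℂ[X]) =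
      (X ^ 2 - C x) * (X ^ 2 - C y) := by
    have := congrArg (fun p : ℂ[X] => p.comp (X ^ 2)) h
    simp only [add_comp, mul_comp, sub_comp, pow_comp, X_comp, C_comp] at this
    rw [← this]
    simp only [map_neg, map_add, map_mul]
    ring
  rw [h2, auxQ, h, aux_roots2]
  refine ⟨mul_ne_zero (aux_sq_ne _) (aux_sq_ne _), ?_⟩
  rw [auxP_mul j (aux_sq_ne _) (aux_sq_ne _), auxP_sq, auxP_sq]
  simp
  ring

theorem aux_zero (q₁ q₂ : ℕ) (j : ℕ) :
    ((auxQ q₁ q₂ 0).roots.map (fun ξ => ξ ^ j)).sum = (-(q₁ : ℂ)) ^ j + (-(q₂ : ℂ)) ^ j := by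
  have : auxQ q₁ q₂ 0 = (X - C (-(q₁ : ℂ))) * (X - C (-(q₂ : ℂ))) := by
    rw [auxQ]
    simp only [map_neg, map_add, map_mul, map_zero]
    ring
  rw [this, aux_roots2]
  simp

theorem aux_filter (q₁ q₂ : ℕ) (hq₁ : 1 ≤ q₁) (hq₂ : 2 ≤ q₂) (j : ℕ) (m : ℂ) :
    ((auxQ q₁ q₂ m).roots.map (fun ξ => ξ ^ j)).sum =
      (((auxQ q₁ q₂ m).roots.filter (fun ξ => ξ ≠ 1)).map (fun ξ => ξ ^ j)).sum +
      if m = (q₁ + 1) * (q₂ + 1) then 1 else 0 := by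
  split_ifs with h
  · have h1 : auxQ q₁ q₂ m = (X - C 1) * (X - C ((q₁ : ℂ) * q₂)) := by
      rw [auxQ, h]
      simp only [map_neg, map_add, map_mul, map_one]
      ring
    have h2 : (q₁ : ℂ) * q₂ ≠ 1 := by
      norm_cast
      nlinarith
    rw [h1, aux_roots2]
    simp [Multiset.filter_singleton, h2]
    ring
  · rw [add_zero, Multiset.filter_eq_self.mpr]
    rintro x hx rfl
    apply h
    have := Polynomial.isRoot_of_mem_roots hx
    simp [auxQ, Polynomial.IsRoot] at this
    linear_combination -this

theorem aux_sum_filter {α M : Type*} [AddCommMonoid M] (s : Multiset α) (p : α → Prop)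
    [DecidablePred p] (g : α → M) :
    ((s.filter p).map g).sum = (s.map (fun x => if p x then g x else 0)).sum := by
  induction s using Multiset.induction_on with
  | empty => simp
  | cons a s ih => by_cases h : p a <;> simp [h, ih]

/-- The biadjacency matrix. -/
def auxB {U W : Type*} (G : SimpleGraph (U ⊕ W)) [DecidableRel G.Adj]
    (R : Type*) [Zero R] [One R] : Matrix U W R :=
  Matrix.of fun u w => if G.Adj (Sum.inl u) (Sum.inr w) then 1 else 0

theorem auxB_map {U W : Type*} [Fintype U] (G : SimpleGraph (U ⊕ W)) [DecidableRel G.Adj]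
    {R : Type*} [CommRing R] (φ : ℝ →+* R) :
    (auxB G R)ᵀ * auxB G R = ((auxB G ℝ)ᵀ * auxB G ℝ).map φ := by
  rw [Matrix.map_mul]
  have : (auxB G ℝ).map φ = auxB G R := by
    ext u w
    simp [auxB, apply_ite φ]
  rw [← this, Matrix.transpose_map]

theorem aux_adj_blocks {U W : Type*} (G : SimpleGraph (U ⊕ W)) [DecidableRel G.Adj]
    (hbipL : ∀ u u' : U, ¬ G.Adj (Sum.inl u) (Sum.inl u'))
    (hbipR : ∀ w w' : W, ¬ G.Adj (Sum.inr w) (Sum.inr w')) (R : Type*) [CommRing R] :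
    G.adjMatrix R = Matrix.fromBlocks 0 (auxB G R) (auxB G R)ᵀ 0 := by
  ext (a | a) (b | b)
  · simp [hbipL]
  · simp [auxB]
  · simp [auxB, G.adj_comm (Sum.inr a)]
  · simp [hbipR]

theorem auxN_herm {U W : Type*} [Fintype U] [Fintype W] (G : SimpleGraph (U ⊕ W)) [DecidableRel G.Adj] :
    ((auxB G ℝ)ᵀ * auxB G ℝ).PosSemidef := by
  have := Matrix.posSemidef_conjTranspose_mul_self (auxB G ℝ)
  simpa using this

theorem aux_charpoly {m R : Type*} [Fintype m] [DecidableEq m] [CommRing R] (M : Matrix m m R) :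
    M.charpoly = ((X : R[X]) • (1 : Matrix m m R[X]) - M.map C).det := by
  rw [Matrix.charpoly, Matrix.charmatrix]
  simp [Matrix.smul_one_eq_diagonal]

theorem aux_adj_charpoly {U W : Type*} [Fintype U] [Fintype W] [DecidableEq U] [DecidableEq W]
    (G : SimpleGraph (U ⊕ W)) [DecidableRel G.Adj]
    (hbipL : ∀ u u' : U, ¬ G.Adj (Sum.inl u) (Sum.inl u'))
    (hbipR : ∀ w w' : W, ¬ G.Adj (Sum.inr w) (Sum.inr w')) :
    (G.adjMatrix ℝ).charpoly * X ^ Fintype.card W = X ^ Fintype.card U *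
      ∏ i, ((X - C (√((auxN_herm G).isHermitian.eigenvalues i))) *
        (X - C (-√((auxN_herm G).isHermitian.eigenvalues i)))) := by
  have h := aux_block_det (auxB G ℝ[X]) X 1 X
  rw [auxB_map G (C : ℝ →+* ℝ[X]), aux_herm_det _ (auxN_herm G).isHermitian] at h
  have h1 : (G.adjMatrix ℝ).charpoly = (Matrix.fromBlocks ((X : ℝ[X]) • (1 : Matrix U U ℝ[X]))
      (-((1 : ℝ[X]) • (auxB G ℝ[X]))) (-((1 : ℝ[X]) • (auxB G ℝ[X])ᵀ))
      ((X : ℝ[X]) • (1 : Matrix W W ℝ[X]))).det := by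
    rw [aux_charpoly]
    congr 1
    have : (G.adjMatrix ℝ).map (C : ℝ →+* ℝ[X]) = G.adjMatrix ℝ[X] := by
      ext a b
      simp [apply_ite (C : ℝ →+* ℝ[X])]
    rw [this, aux_adj_blocks G hbipL hbipR, ← Matrix.fromBlocks_one, Matrix.fromBlocks_smul,
      sub_eq_add_neg, Matrix.fromBlocks_neg, Matrix.fromBlocks_add]
    simp
  rw [h1, h]
  congr 1
  apply Finset.prod_congr rfl
  intro i _
  have h0 := (auxN_herm G).eigenvalues_nonneg i
  have h2 : C ((auxN_herm G).isHermitian.eigenvalues i) =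
      C (√((auxN_herm G).isHermitian.eigenvalues i)) ^ 2 := by
    rw [← map_pow, Real.sq_sqrt h0]
  rw [h2, map_neg]
  ring

theorem aux_adj_sum {U W : Type*} [Fintype U] [Fintype W] [DecidableEq U] [DecidableEq W]
    (G : SimpleGraph (U ⊕ W)) [DecidableRel G.Adj]
    (hbipL : ∀ u u' : U, ¬ G.Adj (Sum.inl u) (Sum.inl u'))
    (hbipR : ∀ w w' : W, ¬ G.Adj (Sum.inr w) (Sum.inr w')) {M : Type*} [AddCommMonoid M]
    (g : ℝ → M) (hg : g 0 = 0) :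
    ((G.adjMatrix ℝ).charpoly.roots.map g).sum =
      ∑ i, (g (√((auxN_herm G).isHermitian.eigenvalues i)) +
        g (-√((auxN_herm G).isHermitian.eigenvalues i))) := by
  have h := congrArg (fun p : ℝ[X] => (p.roots.map g).sum) (aux_adj_charpoly G hbipL hbipR)
  have hne : ∏ i, ((X - C (√((auxN_herm G).isHermitian.eigenvalues i))) *
        (X - C (-√((auxN_herm G).isHermitian.eigenvalues i)))) ≠ 0 :=
    Finset.prod_ne_zero_iff.mpr fun i _ => mul_ne_zero (X_sub_C_ne_zero _) (X_sub_C_ne_zero _)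
  rw [Polynomial.roots_mul (mul_ne_zero (Matrix.charpoly_monic _).ne_zero (pow_ne_zero _ X_ne_zero)),
    Polynomial.roots_mul (mul_ne_zero (pow_ne_zero _ X_ne_zero) hne),
    Polynomial.roots_prod _ _ hne] at h
  simp only [Multiset.map_add, Multiset.sum_add, Polynomial.roots_pow, Polynomial.roots_X,
    Multiset.map_nsmul, Multiset.sum_nsmul, Multiset.map_singleton, Multiset.sum_singleton, hg,
    smul_zero, add_zero, zero_add, Multiset.map_bind, Multiset.sum_bind] at h
  rw [h]
  apply Finset.sum_congr rfl
  intro i _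
  rw [Polynomial.roots_mul (mul_ne_zero (X_sub_C_ne_zero _) (X_sub_C_ne_zero _))]
  simp

theorem aux_rank {U W : Type*} [Fintype U] [Fintype W] [DecidableEq U] [DecidableEq W]
    (G : SimpleGraph (U ⊕ W)) [DecidableRel G.Adj]
    (hbipL : ∀ u u' : U, ¬ G.Adj (Sum.inl u) (Sum.inl u'))
    (hbipR : ∀ w w' : W, ¬ G.Adj (Sum.inr w) (Sum.inr w')) :
    (G.adjMatrix ℝ).rank = 2 * ((auxB G ℝ)ᵀ * auxB G ℝ).rank := by
  have h := aux_adj_sum G hbipL hbipR (fun x => if x ≠ 0 then (1 : ℕ) else 0) (by simp)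
  have hA := G.isHermitian_adjMatrix ℝ
  rw [hA.rank_eq_card_non_zero_eigs, (auxN_herm G).isHermitian.rank_eq_card_non_zero_eigs]
  rw [hA.roots_charpoly_eq_eigenvalues] at h
  have h1 : ∀ i, √((auxN_herm G).isHermitian.eigenvalues i) = 0 ↔
      (auxN_herm G).isHermitian.eigenvalues i = 0 :=
    fun i => Real.sqrt_eq_zero ((auxN_herm G).eigenvalues_nonneg i)
  rw [Fintype.card_subtype, Fintype.card_subtype, Finset.card_filter, Finset.card_filter,
    Finset.mul_sum]
  rw [Multiset.map_map] at h
  refine Eq.trans ?_ (h.trans ?_)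
  · rfl
  · apply Finset.sum_congr rfl
    intro i _
    by_cases h2 : (auxN_herm G).isHermitian.eigenvalues i = 0 <;> simp [h1, h2]

theorem aux_perron {U W : Type*} [Fintype U] [Fintype W] [DecidableEq U] [DecidableEq W]
    (G : SimpleGraph (U ⊕ W)) [DecidableRel G.Adj]
    (hbipL : ∀ u u' : U, ¬ G.Adj (Sum.inl u) (Sum.inl u'))
    (hbipR : ∀ w w' : W, ¬ G.Adj (Sum.inr w) (Sum.inr w'))
    (hconn : G.Connected) (q₁ q₂ : ℕ)
    (hdegU : ∀ u : U, G.degree (Sum.inl u) = q₁ + 1)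
    (hdegW : ∀ w : W, G.degree (Sum.inr w) = q₂ + 1) :
    (Finset.univ.filter (fun i => (auxN_herm G).isHermitian.eigenvalues i =
      ((q₁ : ℝ) + 1) * (q₂ + 1))).card = 1 := by
  have hadj : ∀ (f : U → ℝ) (g : W → ℝ), G.adjMatrix ℝ *ᵥ (Sum.elim f g) =
      Sum.elim (auxB G ℝ *ᵥ g) ((auxB G ℝ)ᵀ *ᵥ f) := by
    intro f g
    rw [aux_adj_blocks G hbipL hbipR, Matrix.fromBlocks_mulVec]
    simp
  have hdeg : ∀ (f : U → ℝ) (g : W → ℝ), G.degMatrix ℝ *ᵥ (Sum.elim f g) =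
      Sum.elim (((q₁ : ℝ) + 1) • f) (((q₂ : ℝ) + 1) • g) := by
    intro f g
    ext (a | a)
    · simp [SimpleGraph.degMatrix_mulVec_apply, hdegU]
    · simp [SimpleGraph.degMatrix_mulVec_apply, hdegW]
  have hq : ((q₁ : ℝ) + 1) ≠ 0 := by positivity
  -- eigenvectors are constant
  have hconst : ∀ v : W → ℝ, ((auxB G ℝ)ᵀ * auxB G ℝ) *ᵥ v = (((q₁ : ℝ) + 1) * (q₂ + 1)) • v →
      ∀ a b, v a = v b := by
    intro v hv a b
    have h0 : G.lapMatrix ℝ *ᵥ (Sum.elim (((q₁ : ℝ) + 1)⁻¹ • (auxB G ℝ *ᵥ v)) v) = 0 := by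
      rw [SimpleGraph.lapMatrix, Matrix.sub_mulVec, hadj, hdeg, Matrix.mulVec_smul,
        Matrix.mulVec_mulVec, hv, smul_smul, smul_smul, mul_inv_cancel₀ hq,
        inv_mul_cancel_left₀ hq, one_smul, sub_self]
    exact (G.lapMatrix_mulVec_eq_zero_iff_forall_reachable.mp h0) (Sum.inr a) (Sum.inr b)
      (hconn.preconnected _ _)
  have hW : Nonempty W := by
    obtain ⟨u | w⟩ := hconn.nonempty
    · have : 0 < G.degree (Sum.inl u) := by rw [hdegU]; omega
      obtain ⟨x, hx⟩ := (G.degree_pos_iff_exists_adj _).mp this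
      rcases x with x | x
      · exact absurd hx (hbipL _ _)
      · exact ⟨x⟩
    · exact ⟨w⟩
  have hone : ((auxB G ℝ)ᵀ * auxB G ℝ) *ᵥ (fun _ => (1 : ℝ)) =
      (((q₁ : ℝ) + 1) * (q₂ + 1)) • (fun _ => (1 : ℝ)) := by
    have h1 := G.lapMatrix_mulVec_const_eq_zero (R := ℝ)
    have h2 : (fun _ => (1 : ℝ)) = Sum.elim (fun _ : U => (1 : ℝ)) (fun _ : W => (1 : ℝ)) := by
      ext (a | a) <;> rfl
    rw [SimpleGraph.lapMatrix, Matrix.sub_mulVec, h2, hadj, hdeg, sub_eq_zero] at h1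
    have h3 := congrArg (fun f => f ∘ Sum.inl) h1
    have h4 := congrArg (fun f => f ∘ Sum.inr) h1
    simp only [Sum.elim_comp_inl, Sum.elim_comp_inr] at h3 h4
    rw [← Matrix.mulVec_mulVec, ← h3, Matrix.mulVec_smul, ← h4, smul_smul]
  apply le_antisymm
  · rw [Finset.card_le_one]
    intro a ha b hb
    by_contra hab
    simp only [Finset.mem_filter, Finset.mem_univ, true_and] at ha hb
    have h1 := (auxN_herm G).isHermitian.mulVec_eigenvectorBasis a
    have h2 := (auxN_herm G).isHermitian.mulVec_eigenvectorBasis b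
    rw [ha] at h1
    rw [hb] at h2
    have c1 := hconst _ h1
    have c2 := hconst _ h2
    obtain ⟨w⟩ := hW
    set e := (auxN_herm G).isHermitian.eigenvectorBasis
    have horth : inner ℝ (e a) (e b) = 0 := e.orthonormal.2 hab
    have ea : e a ≠ 0 := e.orthonormal.ne_zero a
    have eb : e b ≠ 0 := e.orthonormal.ne_zero b
    have ca : ∀ i, (e a) i = (e a) w := fun i => c1 i w
    have cb : ∀ i, (e b) i = (e b) w := fun i => c2 i w
    have na : (e a) w ≠ 0 := fun h => ea (by ext i; rw [ca i, h]; rfl)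
    have nb : (e b) w ≠ 0 := fun h => eb (by ext i; rw [cb i, h]; rfl)
    rw [PiLp.inner_apply] at horth
    simp only [ca, cb] at horth
    have : (0 : ℝ) < Fintype.card W := by
      have : Nonempty W := ⟨w⟩
      exact_mod_cast Fintype.card_pos
    simp [na, nb] at horth
    exact this.ne' (by exact_mod_cast horth)
  · rw [Nat.one_le_iff_ne_zero, ← Nat.pos_iff_ne_zero, Finset.card_pos]
    have hmem : ((q₁ : ℝ) + 1) * (q₂ + 1) ∈ spectrum ℝ ((auxB G ℝ)ᵀ * auxB G ℝ) := by
      rw [← Matrix.spectrum_toLin']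
      apply Module.End.HasEigenvalue.mem_spectrum
      apply Module.End.hasEigenvalue_of_hasEigenvector (x := fun _ => (1 : ℝ))
      refine ⟨?_, ?_⟩
      · rw [Module.End.mem_eigenspace_iff, Matrix.toLin'_apply]
        exact hone
      · intro h
        obtain ⟨w⟩ := hW
        have := congrFun h w
        simp at this
    rw [(auxN_herm G).isHermitian.spectrum_real_eq_range_eigenvalues] at hmem
    obtain ⟨i, hi⟩ := hmem
    exact ⟨i, by simp [hi]⟩

theorem auxP_J {V : Type*} [Fintype V] [DecidableEq V] (G : SimpleGraph V) [DecidableRel G.Adj]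
    (j : ℕ) : auxP j (auxJ G ℂ).charpoly = Fintype.card G.Dart := by
  have h1 : ∀ η ∈ (auxJ G ℂ).charpoly.roots, η ^ (2 * j) = 1 := by
    intro η hη
    have hr := Polynomial.isRoot_of_mem_roots hη
    rw [Polynomial.IsRoot, Matrix.eval_charpoly] at hr
    have h2 : (Matrix.scalar G.Dart η - auxJ G ℂ) * (Matrix.scalar G.Dart η + auxJ G ℂ) =
        (η ^ 2 - 1) • (1 : Matrix G.Dart G.Dart ℂ) := by
      have : Matrix.scalar G.Dart η = η • (1 : Matrix G.Dart G.Dart ℂ) := by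
        simp [Matrix.smul_one_eq_diagonal]
      rw [this, Matrix.sub_mul, Matrix.mul_add, Matrix.mul_add, auxJ_sq]
      simp [smul_smul, sub_smul, pow_two]
      abel
    have h3 := congrArg Matrix.det h2
    rw [Matrix.det_mul, hr, zero_mul, Matrix.det_smul, Matrix.det_one, mul_one] at h3
    have h4 := eq_zero_of_pow_eq_zero h3.symm
    rw [pow_mul, sub_eq_zero.mp h4, one_pow]
  rw [auxP, Multiset.map_congr rfl h1, Multiset.map_const', Multiset.sum_replicate,
    IsAlgClosed.card_roots_eq_natDegree, Matrix.charpoly_natDegree_eq_dim]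
  simp

theorem auxP_edge {U W : Type*}
    [Fintype U] [Fintype W] [DecidableEq U] [DecidableEq W]
    (G : SimpleGraph (U ⊕ W)) [DecidableRel G.Adj]
    (hbipL : ∀ u u' : U, ¬ G.Adj (Sum.inl u) (Sum.inl u'))
    (hbipR : ∀ w w' : W, ¬ G.Adj (Sum.inr w) (Sum.inr w'))
    (q₁ q₂ : ℕ)
    (hdegU : ∀ u : U, G.degree (Sum.inl u) = q₁ + 1)
    (hdegW : ∀ w : W, G.degree (Sum.inr w) = q₂ + 1)
    (j : ℕ) :
    auxP j (edgeMatrix G ℂ).charpoly + 2 * (Fintype.card U + Fintype.card W)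
      + 2 * Fintype.card W * (-(q₁ : ℂ)) ^ j =
      2 * G.edgeFinset.card + 2 * Fintype.card U * (-(q₁ : ℂ)) ^ j +
      ∑ i, 2 * ((auxQ q₁ q₂ ((auxN_herm G).isHermitian.eigenvalues i : ℝ)).roots.map
        (fun ξ => ξ ^ j)).sum := by
  have h := aux_ihara G (X : ℂ[X])
  have hJ : (auxJ G ℂ).charpoly = ((X : ℂ[X]) • (1 : Matrix G.Dart G.Dart ℂ[X]) -
      auxJ G ℂ[X]).det := by
    rw [aux_charpoly]
    congr 2
    ext e f
    simp [auxJ, apply_ite (C : ℂ →+* ℂ[X])]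
  have hM : (edgeMatrix G ℂ).charpoly = ((X : ℂ[X]) • (1 : Matrix G.Dart G.Dart ℂ[X]) -
      edgeMatrix G ℂ[X]).det := by
    rw [aux_charpoly]
    congr 2
    ext e f
    simp [edgeMatrix, apply_ite (C : ℂ →+* ℂ[X])]
  have hb := aux_block_det (auxB G ℂ[X]) (X ^ 2 + C (q₁ : ℂ)) X (X ^ 2 + C (q₂ : ℂ))
  rw [auxB_map G ((C : ℂ →+* ℂ[X]).comp Complex.ofRealHom),
    aux_herm_det _ (auxN_herm G).isHermitian] at hb
  simp only [RingHom.comp_apply, Complex.ofRealHom_eq_coe] at hb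
  have hD : ((X : ℂ[X]) ^ 2 - 1) • (1 : Matrix (U ⊕ W) (U ⊕ W) ℂ[X]) - (X : ℂ[X]) • G.adjMatrix ℂ[X]
      + G.degMatrix ℂ[X] = Matrix.fromBlocks ((X ^ 2 + C (q₁ : ℂ)) • (1 : Matrix U U ℂ[X]))
      (-((X : ℂ[X]) • (auxB G ℂ[X]))) (-((X : ℂ[X]) • (auxB G ℂ[X])ᵀ))
      ((X ^ 2 + C (q₂ : ℂ)) • (1 : Matrix W W ℂ[X])) := by
    rw [aux_adj_blocks G hbipL hbipR]
    ext (a | a) (b | b)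
    · by_cases hab : a = b
      · subst hab
        simp [SimpleGraph.degMatrix, hdegU]
      · simp [SimpleGraph.degMatrix, hab]
    · simp [SimpleGraph.degMatrix]
    · simp [SimpleGraph.degMatrix]
    · by_cases hab : a = b
      · subst hab
        simp [SimpleGraph.degMatrix, hdegW]
      · simp [SimpleGraph.degMatrix, hab]
  rw [hD, ← hJ, ← hM] at h
  set Δ := (Matrix.fromBlocks ((X ^ 2 + C (q₁ : ℂ)) • (1 : Matrix U U ℂ[X]))
      (-((X : ℂ[X]) • (auxB G ℂ[X]))) (-((X : ℂ[X]) • (auxB G ℂ[X])ᵀ))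
      ((X ^ 2 + C (q₂ : ℂ)) • (1 : Matrix W W ℂ[X]))).det
  have e1 : (X ^ 2 - 1 : ℂ[X]) = X ^ 2 - C 1 := by simp
  have e2 : (X ^ 2 + C (q₁ : ℂ) : ℂ[X]) = X ^ 2 - C (-(q₁ : ℂ)) := by simp
  have n1 : (X ^ 2 - 1 : ℂ[X]) ≠ 0 := e1 ▸ aux_sq_ne 1
  have n2 : (X ^ 2 + C (q₁ : ℂ) : ℂ[X]) ≠ 0 := e2 ▸ aux_sq_ne _
  have p1 : auxP j (X ^ 2 - 1) = 2 := by rw [e1, auxP_sq]; simp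
  have p2 : auxP j (X ^ 2 + C (q₁ : ℂ)) = 2 * (-(q₁ : ℂ)) ^ j := by rw [e2, auxP_sq]
  have nM := (Matrix.charpoly_monic (edgeMatrix G ℂ)).ne_zero
  have nJ := (Matrix.charpoly_monic (auxJ G ℂ)).ne_zero
  have nΔ : Δ ≠ 0 := by
    intro h0
    rw [h0, mul_zero] at h
    exact mul_ne_zero (mul_ne_zero nJ nM) (pow_ne_zero _ n1) h
  have hP := congrArg (auxP j) h
  rw [auxP_mul j (mul_ne_zero nJ nM) (pow_ne_zero _ n1), auxP_mul j nJ nM,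
    auxP_mul j (pow_ne_zero _ n1) nΔ, auxP_pow, auxP_pow, p1, auxP_J,
    SimpleGraph.dart_card_eq_twice_card_edges, Fintype.card_sum] at hP
  have hPb := congrArg (auxP j) hb
  have nquart := fun i => aux_quartic q₁ q₂ j ((auxN_herm G).isHermitian.eigenvalues i : ℝ)
  have hprod : (∏ i, ((X ^ 2 + C (q₁ : ℂ)) * (X ^ 2 + C (q₂ : ℂ)) - X * X *
      C (((auxN_herm G).isHermitian.eigenvalues i : ℝ) : ℂ))) ≠ 0 :=
    Finset.prod_ne_zero_iff.mpr fun i _ => (nquart i).1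
  rw [auxP_mul j nΔ (pow_ne_zero _ n2), auxP_mul j (pow_ne_zero _ n2) hprod,
    auxP_pow, auxP_pow, p2, auxP_prod j _ _ (fun i _ => (nquart i).1),
    Finset.sum_congr rfl (fun i _ => (nquart i).2)] at hPb
  push_cast at hP
  linear_combination hP + hPb


/-- For a connected bi-regular bipartite graph, the power sum `Σ η^k` over the
eigenvalues of the directed edge matrix (for even `k = 2j`) equals the sum over
negative adjacency eigenvalues `λ` (with multiplicity) of twice the sum of `ξ^j`
over the roots `ξ ≠ 1` of `ξ² + (-λ² + q₁ + q₂)ξ + q₁q₂ = 0`, plus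
`(2n - Rank A)·(-q₁)^j + (2m - Rank A)·(-q₂)^j + (2|E| - 2(n+m) + 2)`. -/
theorem power_sum_eigenvalues_edgeMatrix {U W : Type*}
    [Fintype U] [Fintype W] [DecidableEq U] [DecidableEq W]
    (G : SimpleGraph (U ⊕ W)) [DecidableRel G.Adj]
    (hbipL : ∀ u u' : U, ¬ G.Adj (Sum.inl u) (Sum.inl u'))
    (hbipR : ∀ w w' : W, ¬ G.Adj (Sum.inr w) (Sum.inr w'))
    (hconn : G.Connected) (q₁ q₂ : ℕ) (hq₁ : 1 ≤ q₁) (hq₂ : 2 ≤ q₂) (hq₁₂ : q₁ ≤ q₂)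
    (hdegU : ∀ u : U, G.degree (Sum.inl u) = q₁ + 1)
    (hdegW : ∀ w : W, G.degree (Sum.inr w) = q₂ + 1)
    (j : ℕ) (hj : 0 < j) :
    (((edgeMatrix G ℂ).charpoly.roots).map (fun η => η ^ (2 * j))).sum =
      ((((G.adjMatrix ℝ).charpoly.roots.filter (fun lam => lam < 0)).map
        (fun lam => 2 * ((((X ^ 2 + Polynomial.C (-(lam : ℂ) ^ 2 + q₁ + q₂) * X +
            Polynomial.C ((q₁ : ℂ) * q₂)).roots.filter (fun ξ => ξ ≠ 1)).map
              (fun ξ => ξ ^ j)).sum))).sum)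
      + ((2 * Fintype.card U - (G.adjMatrix ℝ).rank : ℕ) : ℂ) * (-(q₁ : ℂ)) ^ j
      + ((2 * Fintype.card W - (G.adjMatrix ℝ).rank : ℕ) : ℂ) * (-(q₂ : ℂ)) ^ j
      + ((2 * G.edgeFinset.card - 2 * (Fintype.card U + Fintype.card W) + 2 : ℕ) : ℂ) := by
  have hedge := auxP_edge G hbipL hbipR q₁ q₂ hdegU hdegW j
  have hrank := aux_rank G hbipL hbipR
  have hperron := aux_perron G hbipL hbipR hconn q₁ q₂ hdegU hdegW
  have hrW : ((auxB G ℝ)ᵀ * auxB G ℝ).rank ≤ Fintype.card W := Matrix.rank_le_card_width _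
  have hrU : ((auxB G ℝ)ᵀ * auxB G ℝ).rank ≤ Fintype.card U := by
    rw [Matrix.rank_transpose_mul_self]
    exact Matrix.rank_le_card_height _
  have hr := (auxN_herm G).isHermitian.rank_eq_card_non_zero_eigs
  rw [Fintype.card_subtype] at hr
  set r := ((auxB G ℝ)ᵀ * auxB G ℝ).rank
  set μ := (auxN_herm G).isHermitian.eigenvalues with hμ
  have hμ0 : ∀ i, 0 ≤ μ i := (auxN_herm G).eigenvalues_nonneg
  have hcard : Fintype.card U + Fintype.card W ≤ G.edgeFinset.card := by
    have h1 := G.sum_degrees_eq_twice_card_edges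
    rw [Fintype.sum_sum_type] at h1
    simp only [hdegU, hdegW, Finset.sum_const, Finset.card_univ, smul_eq_mul] at h1
    nlinarith
  have hsum : ((((G.adjMatrix ℝ).charpoly.roots.filter (fun lam => lam < 0)).map
        (fun lam => 2 * ((((X ^ 2 + Polynomial.C (-(lam : ℂ) ^ 2 + q₁ + q₂) * X +
            Polynomial.C ((q₁ : ℂ) * q₂)).roots.filter (fun ξ => ξ ≠ 1)).map
              (fun ξ => ξ ^ j)).sum))).sum) =
      ∑ i, if μ i ≠ 0 then 2 * (((auxQ q₁ q₂ (μ i : ℝ)).roots.filter (fun ξ => ξ ≠ 1)).map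
              (fun ξ => ξ ^ j)).sum else 0 := by
    rw [aux_sum_filter, aux_adj_sum G hbipL hbipR _ (by simp)]
    apply Finset.sum_congr rfl
    intro i _
    rw [← hμ]
    have h1 : ¬ √(μ i) < 0 := not_lt.mpr (Real.sqrt_nonneg _)
    rw [if_neg h1, zero_add]
    by_cases h2 : μ i = 0
    · simp [h2]
    · have h3 : -√(μ i) < 0 := by
        have := Real.sqrt_pos.mpr (lt_of_le_of_ne (hμ0 i) (Ne.symm h2))
        linarith
      rw [if_pos h3, if_pos h2]
      have h4 : ((-√(μ i) : ℝ) : ℂ) ^ 2 = (μ i : ℝ) := by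
        rw [← Complex.ofReal_pow, neg_sq, Real.sq_sqrt (hμ0 i)]
      rw [h4, auxQ]
  have hsplit : ∑ i, 2 * ((auxQ q₁ q₂ (μ i : ℝ)).roots.map (fun ξ => ξ ^ j)).sum =
      (∑ i, if μ i ≠ 0 then 2 * (((auxQ q₁ q₂ (μ i : ℝ)).roots.filter (fun ξ => ξ ≠ 1)).map
              (fun ξ => ξ ^ j)).sum else 0) +
      (∑ i, if μ i = ((q₁ : ℝ) + 1) * (q₂ + 1) then (2 : ℂ) else 0) +
      ∑ i, (1 - if μ i ≠ 0 then (1 : ℂ) else 0) * (2 * ((-(q₁ : ℂ)) ^ j + (-(q₂ : ℂ)) ^ j)) := by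
    rw [← Finset.sum_add_distrib, ← Finset.sum_add_distrib]
    apply Finset.sum_congr rfl
    intro i _
    by_cases h2 : μ i = 0
    · have h3 : ¬ (0 : ℝ) = ((q₁ : ℝ) + 1) * (q₂ + 1) := by positivity
      rw [h2, if_neg h3, Complex.ofReal_zero, aux_zero]
      simp
    · rw [if_pos h2, if_pos h2, aux_filter q₁ q₂ hq₁ hq₂]
      by_cases h3 : μ i = ((q₁ : ℝ) + 1) * (q₂ + 1)
      · rw [if_pos h3, if_pos (by rw [h3]; push_cast; rfl)]
        ring
      · rw [if_neg h3, if_neg (by exact_mod_cast h3)]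
        ring
  have hs1 : (∑ i, if μ i = ((q₁ : ℝ) + 1) * (q₂ + 1) then (2 : ℂ) else 0) = 2 := by
    rw [← Finset.sum_filter, Finset.sum_const, hperron, one_smul]
  have hs2 : ∑ i, (1 - if μ i ≠ 0 then (1 : ℂ) else 0) *
      (2 * ((-(q₁ : ℂ)) ^ j + (-(q₂ : ℂ)) ^ j)) =
      ((Fintype.card W : ℂ) - r) * (2 * ((-(q₁ : ℂ)) ^ j + (-(q₂ : ℂ)) ^ j)) := by
    rw [← Finset.sum_mul, Finset.sum_sub_distrib, Finset.sum_boole, ← hr]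
    simp
  rw [hsum, hrank]
  rw [hsplit, hs1, hs2] at hedge
  rw [Nat.cast_sub (by omega), Nat.cast_sub (by omega), Nat.cast_add, Nat.cast_sub (by omega)]
  push_cast
  change auxP j _ = _
  linear_combination hedge
end
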